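/- arXiv:2511.22257 — 2 statements merged into one kernel-verified Lean document; each statement's English description precedes it below -/
import Mathlib

section
/- Let X ⊆ ℂⁿ be open and let S : X → ℂ be smooth, and let T = ∂∂̄S be the (1,1)-form with coefficients T_{jk} = ∂²S/∂z_j∂z̄_k. If Ω^c is a connected component of X \ supp T, then either supp S ∩ Ω^c = ∅ or Ω^c ⊆ supp S. -/
open Complex

noncomputable section

/-- Wirtinger derivative `∂u/∂z_j` of `u` within the set `X`, at `z`. -/
def wdz {n : ℕ} (X : Set (Fin n → ℂ)) (u : (Fin n → ℂ) → ℂ) (j : Fin n)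
    (z : Fin n → ℂ) : ℂ :=
  (1 / 2 : ℂ) * (fderivWithin ℝ u X z (Pi.single j 1) -
    Complex.I * fderivWithin ℝ u X z (Pi.single j Complex.I))

/-- Wirtinger derivative `∂u/∂z̄_j` of `u` within the set `X`, at `z`. -/
def wdzbar {n : ℕ} (X : Set (Fin n → ℂ)) (u : (Fin n → ℂ) → ℂ) (j : Fin n)
    (z : Fin n → ℂ) : ℂ :=
  (1 / 2 : ℂ) * (fderivWithin ℝ u X z (Pi.single j 1) +
    Complex.I * fderivWithin ℝ u X z (Pi.single j Complex.I))

/-- `∂²u/∂z_j∂z̄_k` within `X`. -/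
def ddbar {n : ℕ} (X : Set (Fin n → ℂ)) (u : (Fin n → ℂ) → ℂ) (j k : Fin n)
    (z : Fin n → ℂ) : ℂ :=
  wdz X (wdzbar X u k) j z

/-- The support of `u` as a function on `X`: the closure in `X` of its nonvanishing set. -/
def suppIn {n : ℕ} (X : Set (Fin n → ℂ)) (u : (Fin n → ℂ) → ℂ) : Set (Fin n → ℂ) :=
  X ∩ closure {z | z ∈ X ∧ u z ≠ 0}

/-- Support of a (1,1)-form given by its coefficient matrix. -/
def supp11 {n : ℕ} (X : Set (Fin n → ℂ)) (T : Fin n → Fin n → (Fin n → ℂ) → ℂ) :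
    Set (Fin n → ℂ) :=
  ⋃ j, ⋃ k, suppIn X (T j k)

/-- Support of a 1-form `Σ a_j dz_j + Σ b_k dz̄_k`. -/
def supp1 {n : ℕ} (X : Set (Fin n → ℂ)) (a b : Fin n → (Fin n → ℂ) → ℂ) :
    Set (Fin n → ℂ) :=
  (⋃ j, suppIn X (a j)) ∪ (⋃ k, suppIn X (b k))

/-- Smoothness of the coefficients of a (1,1)-form on `X`. -/
def Smooth11 {n : ℕ} (X : Set (Fin n → ℂ)) (f : Fin n → Fin n → (Fin n → ℂ) → ℂ) : Prop :=
  ∀ j k, ContDiffOn ℝ (⊤ : ℕ∞) (f j k) X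

/-- A (1,1)-form `Σ f_{jk} dz_j ∧ dz̄_k` is d-closed. -/
def DClosed11 {n : ℕ} (X : Set (Fin n → ℂ)) (f : Fin n → Fin n → (Fin n → ℂ) → ℂ) : Prop :=
  ∀ j k l, ∀ z ∈ X,
    wdz X (f j k) l z = wdz X (f l k) j z ∧ wdzbar X (f j k) l z = wdzbar X (f j l) k z

/-- `d(Σ a_j dz_j + Σ b_k dz̄_k) = f` for a (1,1)-form `f`. -/
def IsDOf {n : ℕ} (X : Set (Fin n → ℂ)) (a b : Fin n → (Fin n → ℂ) → ℂ)
    (f : Fin n → Fin n → (Fin n → ℂ) → ℂ) : Prop :=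
  (∀ j k, ∀ z ∈ X, f j k z = wdz X (b k) j z - wdzbar X (a j) k z) ∧
  (∀ j l, ∀ z ∈ X, wdz X (a j) l z = wdz X (a l) j z) ∧
  (∀ k l, ∀ z ∈ X, wdzbar X (b k) l z = wdzbar X (b l) k z)

/-- A (0,1)-form `Σ b_k dz̄_k` is ∂̄-closed. -/
def DbarClosed01 {n : ℕ} (X : Set (Fin n → ℂ)) (b : Fin n → (Fin n → ℂ) → ℂ) : Prop :=
  ∀ k l, ∀ z ∈ X, wdzbar X (b k) l z = wdzbar X (b l) k z

/-- A (1,0)-form `Σ a_j dz_j` is ∂-closed. -/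
def DClosed10 {n : ℕ} (X : Set (Fin n → ℂ)) (a : Fin n → (Fin n → ℂ) → ℂ) : Prop :=
  ∀ j l, ∀ z ∈ X, wdz X (a j) l z = wdz X (a l) j z

/-- A real-differentiable function satisfying the Cauchy-Riemann equations in every coordinate is
complex differentiable. -/
theorem differentiableAt_complex_of_cauchyRiemann {n : ℕ} {f : (Fin n → ℂ) → ℂ} {z : Fin n → ℂ}
    (hf : DifferentiableAt ℝ f z)
    (h : ∀ j, fderiv ℝ f z (Pi.single j Complex.I) =
      Complex.I * fderiv ℝ f z (Pi.single j 1)) :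
    DifferentiableAt ℂ f z := by
  rw [differentiableAt_iff_restrictScalars ℝ hf]
  refine ⟨∑ j, (ContinuousLinearMap.proj (R := ℂ) (φ := fun _ : Fin n => ℂ) j).smulRight
    (fderiv ℝ f z (Pi.single j 1)), ?_⟩
  ext v
  have key : ∀ j, fderiv ℝ f z (Pi.single j (v j)) =
      v j * fderiv ℝ f z (Pi.single j 1) := by
    intro j
    have hdec : (Pi.single j (v j) : Fin n → ℂ) =
        (v j).re • (Pi.single j 1 : Fin n → ℂ) + (v j).im • (Pi.single j Complex.I : Fin n → ℂ) := by
      rw [← Pi.single_smul, ← Pi.single_smul, ← Pi.single_add]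
      congr 1
      simp [Complex.re_add_im]
    rw [hdec, map_add, map_smul, map_smul, h j]
    conv_rhs => rw [← Complex.re_add_im (v j)]
    simp only [Complex.real_smul]
    ring
  conv_rhs => rw [← Finset.univ_sum_single v, map_sum]
  simp [key]

/-- Identity theorem on convex sets: a holomorphic function on a convex open subset of a complex
normed space vanishes identically if it vanishes near one point. -/
theorem eqOn_zero_of_convex_of_eventuallyEq_zero {E : Type*} [NormedAddCommGroup E]
    [NormedSpace ℂ E] {f : E → ℂ} {U : Set E} (hU : IsOpen U) (hc : Convex ℝ U)
    (hf : DifferentiableOn ℂ f U) {a : E} (ha : a ∈ U) (h0 : f =ᶠ[nhds a] 0) :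
    Set.EqOn f 0 U := by
  intro w hw
  let L : ℂ → E := fun t => a + t • (w - a)
  have hL : Differentiable ℂ L := by fun_prop
  have hL0 : L 0 = a := by simp [L]
  have hL1 : L 1 = w := by simp [L]
  have hV : IsOpen (L ⁻¹' U) := hU.preimage hL.continuous
  have hVc : Convex ℝ (L ⁻¹' U) := (hc.translate_preimage_right a).linear_preimage
    ((LinearMap.toSpanSingleton ℂ E (w - a)).restrictScalars ℝ)
  have hd : DifferentiableOn ℂ (f ∘ L) (L ⁻¹' U) :=
    hf.comp hL.differentiableOn fun _ ht => ht
  have h0' : f ∘ L =ᶠ[nhds 0] 0 := by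
    have hcont := hL.continuous.tendsto 0
    rw [hL0] at hcont
    exact hcont.eventually h0
  have h1 := (hd.analyticOnNhd hV).eqOn_zero_of_preconnected_of_eventuallyEq_zero
    hVc.isPreconnected (by simpa [hL0] using ha) h0' (show (1 : ℂ) ∈ L ⁻¹' U by simpa [hL1] using hw)
  simpa [hL1] using h1

/-- Identity theorem: a holomorphic function on a preconnected open subset of a complex normed
space vanishes identically if it vanishes near one point. -/
theorem eqOn_zero_of_isPreconnected_of_eventuallyEq_zero {E : Type*} [NormedAddCommGroup E]
    [NormedSpace ℂ E] {f : E → ℂ} {U : Set E} (hU : IsOpen U) (hc : IsPreconnected U)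
    (hf : DifferentiableOn ℂ f U) {a : E} (ha : a ∈ U) (h0 : f =ᶠ[nhds a] 0) :
    Set.EqOn f 0 U := by
  have hsub : U ⊆ {z | f =ᶠ[nhds z] 0} := by
    refine hc.subset_of_closure_inter_subset isOpen_setOfPred_eventually_nhds ⟨a, ha, h0⟩ ?_
    rintro z ⟨hz, hzU⟩
    obtain ⟨r, hr, hball⟩ := Metric.isOpen_iff.1 hU z hzU
    obtain ⟨b, hb, hbz⟩ := Metric.mem_closure_iff.1 hz r hr
    have hzero := eqOn_zero_of_convex_of_eventuallyEq_zero Metric.isOpen_ball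
      (by let _ := NormedSpace.restrictScalars ℝ ℂ E; exact convex_ball z r) (hf.mono hball)
      (Metric.mem_ball'.2 hbz) hb
    exact hzero.eventuallyEq_of_mem (Metric.ball_mem_nhds z hr)
  exact fun z hz => (hsub hz).self_of_nhds

/-- The Wirtinger derivative `∂u/∂z̄_k` of a smooth function is smooth. -/
theorem contDiffOn_wdzbar {n : ℕ} {X : Set (Fin n → ℂ)} (hX : IsOpen X) {u : (Fin n → ℂ) → ℂ}
    (hu : ContDiffOn ℝ (⊤ : ℕ∞) u X) (k : Fin n) :
    ContDiffOn ℝ (⊤ : ℕ∞) (wdzbar X u k) X := by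
  have hd : ContDiffOn ℝ (⊤ : ℕ∞) (fderivWithin ℝ u X) X :=
    hu.fderivWithin hX.uniqueDiffOn (by simp)
  unfold wdzbar
  exact contDiffOn_const.mul ((hd.clm_apply contDiffOn_const).add
    (contDiffOn_const.mul (hd.clm_apply contDiffOn_const)))

/-- A function with vanishing `∂u/∂z̄_k` for all `k` is holomorphic. -/
theorem differentiableAt_of_wdzbar_eq_zero {n : ℕ} {X : Set (Fin n → ℂ)} (hX : IsOpen X)
    {u : (Fin n → ℂ) → ℂ} {z : Fin n → ℂ} (hz : z ∈ X) (hu : DifferentiableAt ℝ u z)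
    (h : ∀ k, wdzbar X u k z = 0) : DifferentiableAt ℂ u z := by
  refine differentiableAt_complex_of_cauchyRiemann hu fun k => ?_
  have hk := h k
  rw [wdzbar, fderivWithin_of_isOpen hX hz] at hk
  linear_combination (-2 * Complex.I) * hk -
    fderiv ℝ u z (Pi.single k Complex.I) * (-Complex.I_sq)

/-- The conjugate of a function with vanishing `∂u/∂z_j` for all `j` is holomorphic. -/
theorem differentiableAt_conj_of_wdz_eq_zero {n : ℕ} {X : Set (Fin n → ℂ)} (hX : IsOpen X)
    {u : (Fin n → ℂ) → ℂ} {z : Fin n → ℂ} (hz : z ∈ X) (hu : DifferentiableAt ℝ u z)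
    (h : ∀ j, wdz X u j z = 0) :
    DifferentiableAt ℂ (fun w => (starRingEnd ℂ) (u w)) z := by
  have hd : HasFDerivAt (fun w => (starRingEnd ℂ) (u w))
      ((Complex.conjCLE : ℂ →L[ℝ] ℂ).comp (fderiv ℝ u z)) z :=
    (Complex.conjCLE : ℂ →L[ℝ] ℂ).hasFDerivAt.comp z hu.hasFDerivAt
  refine differentiableAt_complex_of_cauchyRiemann hd.differentiableAt fun j => ?_
  have hj := h j
  rw [wdz, fderivWithin_of_isOpen hX hz] at hj
  have hI : fderiv ℝ u z (Pi.single j Complex.I) =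
      -Complex.I * fderiv ℝ u z (Pi.single j 1) := by
    linear_combination (2 * Complex.I) * hj +
      fderiv ℝ u z (Pi.single j Complex.I) * Complex.I_sq
  rw [hd.fderiv]
  simp [hI]

/-- If `T = ∂∂̄S` and `Ωᶜ` is a connected component of `X \ supp T`,
then `supp S ∩ Ωᶜ = ∅` or `Ωᶜ ⊆ supp S`. -/
theorem stmt0 {n : ℕ} (hn : 0 < n) (X : Set (Fin n → ℂ)) (hX : IsOpen X)
    (S : (Fin n → ℂ) → ℂ) (hS : ContDiffOn ℝ (⊤ : ℕ∞) S X)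
    (T : Fin n → Fin n → (Fin n → ℂ) → ℂ)
    (hT : ∀ j k, ∀ z ∈ X, T j k z = ddbar X S j k z)
    (Ωc : Set (Fin n → ℂ))
    (hΩc : ∃ x ∈ X \ supp11 X T, Ωc = connectedComponentIn (X \ supp11 X T) x) :
    suppIn X S ∩ Ωc = ∅ ∨ Ωc ⊆ suppIn X S := by
  obtain ⟨x, -, rfl⟩ := hΩc
  set Y := X \ supp11 X T with hY
  have hYX : Y ⊆ X := Set.sdiff_subset
  have hYopen : IsOpen Y := by
    have hYeq : Y = X \ ⋃ j, ⋃ k, closure {z | z ∈ X ∧ T j k z ≠ 0} := by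
      ext z
      simp only [hY, supp11, suppIn, Set.mem_sdiff, Set.mem_iUnion, Set.mem_inter_iff]
      exact and_congr_right fun hz => by simp [hz]
    rw [hYeq]
    exact hX.sdiff (isClosed_iUnion_of_finite fun j =>
      isClosed_iUnion_of_finite fun k => isClosed_closure)
  have hTzero : ∀ z ∈ Y, ∀ j k, ddbar X S j k z = 0 := by
    intro z hz j k
    rw [← hT j k z (hYX hz)]
    by_contra hne
    exact hz.2 (Set.mem_iUnion₂.2 ⟨j, k, hYX hz, subset_closure ⟨hYX hz, hne⟩⟩)
  set Ω := connectedComponentIn Y x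
  have hΩY : Ω ⊆ Y := connectedComponentIn_subset Y x
  have hΩX : Ω ⊆ X := hΩY.trans hYX
  have hΩopen : IsOpen Ω := hYopen.connectedComponentIn
  have hΩconn : IsPreconnected Ω := isPreconnected_connectedComponentIn
  have hdiff : ∀ {u : (Fin n → ℂ) → ℂ}, ContDiffOn ℝ (⊤ : ℕ∞) u X → ∀ z ∈ Ω,
      DifferentiableAt ℝ u z := fun hu z hz =>
    (hu.differentiableOn (by simp)).differentiableAt (hX.mem_nhds (hΩX hz))
  rw [or_iff_not_imp_right, Set.not_subset]
  rintro ⟨a, ha, haS⟩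
  have hSa : S =ᶠ[nhds a] 0 := by
    have hnot : a ∉ closure {z | z ∈ X ∧ S z ≠ 0} := fun hcl => haS ⟨hΩX ha, hcl⟩
    filter_upwards [isClosed_closure.isOpen_compl.mem_nhds hnot, hX.mem_nhds (hΩX ha)]
      with z hz hzX
    by_contra hne
    exact hz (subset_closure ⟨hzX, hne⟩)
  have hbar : ∀ k, ∀ z ∈ Ω, wdzbar X S k z = 0 := by
    intro k z hz
    have hzero := eqOn_zero_of_isPreconnected_of_eventuallyEq_zero hΩopen hΩconn
      (f := fun w => (starRingEnd ℂ) (wdzbar X S k w))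
      (fun w hw => (differentiableAt_conj_of_wdz_eq_zero hX (hΩX hw)
        (hdiff (contDiffOn_wdzbar hX hS k) w hw)
        fun j => hTzero w (hΩY hw) j k).differentiableWithinAt) ha (by
        filter_upwards [hSa.fderiv (𝕜 := ℝ), hX.mem_nhds (hΩX ha)] with w hw hwX
        have hw0 : fderiv ℝ S w = 0 := by simp [hw]
        simp [wdzbar, fderivWithin_of_isOpen hX hwX, hw0])
    simpa using hzero hz
  have hSzero := eqOn_zero_of_isPreconnected_of_eventuallyEq_zero hΩopen hΩconn
    (fun z hz => (differentiableAt_of_wdzbar_eq_zero hX (hΩX hz) (hdiff hS z hz)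
      fun k => hbar k z hz).differentiableWithinAt) ha hSa
  refine Set.eq_empty_of_forall_notMem ?_
  rintro z ⟨⟨-, hzcl⟩, hzΩ⟩
  obtain ⟨w, hwΩ, -, hw⟩ := mem_closure_iff.1 hzcl Ω hΩopen hzΩ
  exact hw (hSzero hwΩ)
end
end

section
/- Let X ⊆ ℂⁿ be open and connected, and let S, U : X → ℂ be smooth functions with ∂∂̄S = ∂∂̄U =: T (i.e. ∂²S/∂z_j∂z̄_k = ∂²U/∂z_j∂z̄_k for all j,k). Assume X \ supp T ≠ ∅ and that there exists a connected component Ω^c of X \ supp T such that supp S ∩ Ω^c = ∅ and supp U ∩ Ω^c = ∅. Then S = U on X. In particular, when X \ supp T ≠ ∅, there is at most one smooth function S with ∂∂̄S = T and supp S = supp T. -/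
open Complex

noncomputable section

open Filter Topology in
/-- Identity theorem for holomorphic functions on a complex normed space. -/
theorem eqOn_zero_of_differentiableOn_of_eventuallyEq {E : Type*} [NormedAddCommGroup E]
    [NormedSpace ℂ E] {X : Set E} (hX : IsOpen X) (hXc : IsPreconnected X) {f : E → ℂ}
    (hf : DifferentiableOn ℂ f X) {x : E} (hx : x ∈ X) (h0 : f =ᶠ[𝓝 x] 0) :
    Set.EqOn f 0 X := by
  have hA : IsOpen {y | f =ᶠ[𝓝 y] 0} := isOpen_setOfPred_eventually_nhds
  have hsub : X ⊆ {y | f =ᶠ[𝓝 y] 0} := by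
    refine hXc.subset_of_closure_inter_subset hA ⟨x, hx, h0⟩ ?_
    rintro y ⟨hy, hyX⟩
    obtain ⟨r, hr, hball⟩ := Metric.isOpen_iff.1 hX y hyX
    obtain ⟨p, hp, hpy⟩ := Metric.mem_closure_iff.1 hy r hr
    have hpb : p ∈ Metric.ball y r := by rwa [Metric.mem_ball, dist_comm]
    have hzero : ∀ q ∈ Metric.ball y r, f q = 0 := by
      intro q hq
      let l : ℂ → E := fun t => p + t • (q - p)
      have hl : Differentiable ℂ l := by fun_prop
      have hD : IsOpen (l ⁻¹' Metric.ball y r) := Metric.isOpen_ball.preimage hl.continuous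
      have hconv : Convex ℝ (l ⁻¹' Metric.ball y r) := by
        intro s hs t ht a b ha hb hab
        have hcomb : l (a • s + b • t) = a • l s + b • l t := by
          have hb' : b = 1 - a := by linarith
          subst hb'
          simp only [l, smul_add, add_smul, smul_assoc]
          module
        simp only [Set.mem_preimage, hcomb]
        exact convex_ball y r hs ht ha hb hab
      have hd : DifferentiableOn ℂ (f ∘ l) (l ⁻¹' Metric.ball y r) :=
        (hf.mono hball).comp hl.differentiableOn fun _ h => h
      have hl0 : l 0 = p := by simp [l]
      have hl1 : l 1 = q := by simp [l]
      have hev : f ∘ l =ᶠ[𝓝 0] 0 := by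
        have ht : Tendsto l (𝓝 0) (𝓝 p) := hl0 ▸ hl.continuous.tendsto 0
        exact ht.eventually hp
      have := (hd.analyticOnNhd hD).eqOn_zero_of_preconnected_of_eventuallyEq_zero
        hconv.isPreconnected (z₀ := 0) (by simpa [hl0] using hpb) hev
        (show (1 : ℂ) ∈ l ⁻¹' Metric.ball y r by simpa [hl1] using hq)
      simpa [hl1] using this
    filter_upwards [Metric.ball_mem_nhds y hr] with q hq using hzero q hq
  exact fun y hy => (hsub hy).self_of_nhds

/-- A real-linear map on `ℂⁿ` commuting with `I` on the standard basis is complex-linear. -/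
theorem exists_restrictScalars_eq_of_map_single_I {n : ℕ} (L : (Fin n → ℂ) →L[ℝ] ℂ)
    (h : ∀ j, L (Pi.single j I) = I * L (Pi.single j 1)) :
    ∃ g : (Fin n → ℂ) →L[ℂ] ℂ, g.restrictScalars ℝ = L := by
  refine ⟨∑ j, L (Pi.single j 1) • ContinuousLinearMap.proj j, ?_⟩
  ext v
  have hsingle (j : Fin n) : L (Pi.single j (v j)) = L (Pi.single j 1) * v j := by
    have hv : (Pi.single j (v j) : Fin n → ℂ) =
        (v j).re • (Pi.single j 1 : Fin n → ℂ) + (v j).im • (Pi.single j I : Fin n → ℂ) := by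
      rw [← Pi.single_smul', ← Pi.single_smul', ← Pi.single_add]
      congr 1
      simp [re_add_im]
    rw [hv, map_add, map_smul, map_smul, h, real_smul, real_smul]
    conv_rhs => rw [← re_add_im (v j)]
    ring
  conv_rhs => rw [← Finset.univ_sum_single v, map_sum]
  simp [hsingle]

/-- The Cauchy-Riemann equations imply holomorphy. -/
theorem differentiableOn_complex_of_wdzbar_eq_zero {n : ℕ} {X : Set (Fin n → ℂ)} (hX : IsOpen X)
    {f : (Fin n → ℂ) → ℂ} (hf : DifferentiableOn ℝ f X)
    (h : ∀ k, ∀ z ∈ X, wdzbar X f k z = 0) : DifferentiableOn ℂ f X := by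
  intro z hz
  have hfz : DifferentiableAt ℝ f z := (hf z hz).differentiableAt (hX.mem_nhds hz)
  refine DifferentiableAt.differentiableWithinAt ?_
  rw [differentiableAt_iff_restrictScalars ℝ hfz]
  refine exists_restrictScalars_eq_of_map_single_I _ fun j => ?_
  have hj := h j z hz
  rw [wdzbar, fderivWithin_of_isOpen hX hz] at hj
  linear_combination (-2 * I) * hj + fderiv ℝ f z (Pi.single j I) * I_sq

theorem wdzbar_conj {n : ℕ} {X : Set (Fin n → ℂ)} (hX : IsOpen X) {f : (Fin n → ℂ) → ℂ}
    (j : Fin n) {z : Fin n → ℂ} (hz : z ∈ X) :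
    wdzbar X (fun w => conjCLE (f w)) j z = conjCLE (wdz X f j z) := by
  have hd : fderivWithin ℝ (fun w => conjCLE (f w)) X z =
      (conjCLE : ℂ →L[ℝ] ℂ).comp (fderivWithin ℝ f X z) :=
    conjCLE.comp_fderivWithin (hX.uniqueDiffWithinAt hz)
  rw [wdzbar, wdz, hd]
  simp [sub_eq_add_neg, Complex.conj_ofNat]

theorem wdzbar_sub {n : ℕ} {X : Set (Fin n → ℂ)} (hX : IsOpen X) {f g : (Fin n → ℂ) → ℂ}
    (hf : DifferentiableOn ℝ f X) (hg : DifferentiableOn ℝ g X) (j : Fin n) {z : Fin n → ℂ}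
    (hz : z ∈ X) : wdzbar X (f - g) j z = wdzbar X f j z - wdzbar X g j z := by
  simp only [wdzbar, fderivWithin_sub (hX.uniqueDiffWithinAt hz) (hf z hz) (hg z hz),
    sub_apply]
  ring

theorem wdz_sub {n : ℕ} {X : Set (Fin n → ℂ)} (hX : IsOpen X) {f g : (Fin n → ℂ) → ℂ}
    (hf : DifferentiableOn ℝ f X) (hg : DifferentiableOn ℝ g X) (j : Fin n) {z : Fin n → ℂ}
    (hz : z ∈ X) : wdz X (f - g) j z = wdz X f j z - wdz X g j z := by
  simp only [wdz, fderivWithin_sub (hX.uniqueDiffWithinAt hz) (hf z hz) (hg z hz),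
    sub_apply]
  ring

theorem ddbar_sub {n : ℕ} {X : Set (Fin n → ℂ)} (hX : IsOpen X) {f g : (Fin n → ℂ) → ℂ}
    (hf : ContDiffOn ℝ (⊤ : ℕ∞) f X) (hg : ContDiffOn ℝ (⊤ : ℕ∞) g X) (j k : Fin n)
    {z : Fin n → ℂ} (hz : z ∈ X) : ddbar X (f - g) j k z = ddbar X f j k z - ddbar X g j k z := by
  have hEq : Set.EqOn (wdzbar X (f - g) k) (wdzbar X f k - wdzbar X g k) X := fun w hw =>
    wdzbar_sub hX (hf.differentiableOn (by simp)) (hg.differentiableOn (by simp)) k hw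
  have hcongr : wdz X (wdzbar X (f - g) k) j z = wdz X (wdzbar X f k - wdzbar X g k) j z := by
    rw [wdz, wdz, fderivWithin_congr hEq (hEq hz)]
  rw [ddbar, hcongr, wdz_sub hX ((contDiffOn_wdzbar hX hf k).differentiableOn (by simp))
    ((contDiffOn_wdzbar hX hg k).differentiableOn (by simp)) j hz]
  rfl

open Filter Topology in
/-- A pluriharmonic function on a connected open set vanishing near a point vanishes. -/
theorem eqOn_zero_of_ddbar_eq_zero {n : ℕ} {X : Set (Fin n → ℂ)} (hX : IsOpen X)
    (hXc : IsPreconnected X) {u : (Fin n → ℂ) → ℂ} (hu : ContDiffOn ℝ (⊤ : ℕ∞) u X)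
    (h : ∀ j k, ∀ z ∈ X, ddbar X u j k z = 0) {x : Fin n → ℂ} (hx : x ∈ X)
    (h0 : u =ᶠ[𝓝 x] 0) : Set.EqOn u 0 X := by
  refine eqOn_zero_of_differentiableOn_of_eventuallyEq hX hXc
    (differentiableOn_complex_of_wdzbar_eq_zero hX (hu.differentiableOn (by simp)) ?_) hx h0
  intro k z hz
  have hg := (contDiffOn_wdzbar hX hu k).differentiableOn (by simp)
  have hconj : DifferentiableOn ℂ (fun w => conjCLE (wdzbar X u k w)) X := by
    refine differentiableOn_complex_of_wdzbar_eq_zero hX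
      (conjCLE.differentiable.comp_differentiableOn hg) fun j w hw => ?_
    rw [wdzbar_conj hX j hw]
    simpa [ddbar] using h j k w hw
  have hev : (fun w => conjCLE (wdzbar X u k w)) =ᶠ[𝓝 x] 0 := by
    filter_upwards [h0.eventuallyEq_nhds, hX.mem_nhds hx] with w hw hwX
    have hd : fderiv ℝ u w = 0 := by
      rw [hw.fderiv_eq]
      exact fderiv_const_apply 0
    simp [wdzbar, fderivWithin_of_isOpen hX hwX, hd]
  have hzero := eqOn_zero_of_differentiableOn_of_eventuallyEq hX hXc hconj hx hev hz
  simpa using hzero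

theorem isOpen_diff_supp11 {n : ℕ} {X : Set (Fin n → ℂ)} (hX : IsOpen X)
    (T : Fin n → Fin n → (Fin n → ℂ) → ℂ) : IsOpen (X \ supp11 X T) := by
  have hEq : X \ supp11 X T = X \ ⋃ j, ⋃ k, closure {z | z ∈ X ∧ T j k z ≠ 0} := by
    ext z
    simp only [supp11, suppIn, Set.mem_sdiff, Set.mem_iUnion, Set.mem_inter_iff]
    exact ⟨fun ⟨hz, h⟩ => ⟨hz, fun ⟨j, k, hc⟩ => h ⟨j, k, hz, hc⟩⟩,
      fun ⟨hz, h⟩ => ⟨hz, fun ⟨j, k, _, hc⟩ => h ⟨j, k, hc⟩⟩⟩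
  rw [hEq]
  exact hX.sdiff (isClosed_iUnion_of_finite fun j => isClosed_iUnion_of_finite fun k =>
    isClosed_closure)

theorem eq_zero_of_suppIn_inter_eq_empty {n : ℕ} {X V : Set (Fin n → ℂ)}
    {u : (Fin n → ℂ) → ℂ} (h : suppIn X u ∩ V = ∅) {z : Fin n → ℂ} (hz : z ∈ X) (hzV : z ∈ V) :
    u z = 0 := by
  by_contra hne
  exact Set.eq_empty_iff_forall_notMem.1 h z ⟨⟨hz, subset_closure ⟨hz, hne⟩⟩, hzV⟩

/-- Uniqueness: if `∂∂̄S = ∂∂̄U = T`, `X \ supp T ≠ ∅`, and the supports of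
`S` and `U` both miss some connected component `Ωᶜ` of `X \ supp T`, then `S = U` on `X`.
In particular there is at most one smooth `S` with `∂∂̄S = T` and `supp S = supp T`. -/
theorem stmt2 {n : ℕ} (hn : 0 < n) (X : Set (Fin n → ℂ)) (hX : IsOpen X)
    (hXconn : IsConnected X)
    (S U : (Fin n → ℂ) → ℂ) (hS : ContDiffOn ℝ (⊤ : ℕ∞) S X) (hU : ContDiffOn ℝ (⊤ : ℕ∞) U X)
    (T : Fin n → Fin n → (Fin n → ℂ) → ℂ)
    (hTS : ∀ j k, ∀ z ∈ X, T j k z = ddbar X S j k z)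
    (hTU : ∀ j k, ∀ z ∈ X, T j k z = ddbar X U j k z)
    (hne : (X \ supp11 X T).Nonempty)
    (Ωc : Set (Fin n → ℂ))
    (hΩc : ∃ x ∈ X \ supp11 X T, Ωc = connectedComponentIn (X \ supp11 X T) x)
    (hSΩ : suppIn X S ∩ Ωc = ∅) (hUΩ : suppIn X U ∩ Ωc = ∅) :
    Set.EqOn S U X ∧
      ∀ S₁ S₂ : (Fin n → ℂ) → ℂ, ContDiffOn ℝ (⊤ : ℕ∞) S₁ X → ContDiffOn ℝ (⊤ : ℕ∞) S₂ X →
        (∀ j k, ∀ z ∈ X, T j k z = ddbar X S₁ j k z) →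
        (∀ j k, ∀ z ∈ X, T j k z = ddbar X S₂ j k z) →
        suppIn X S₁ = supp11 X T → suppIn X S₂ = supp11 X T →
        Set.EqOn S₁ S₂ X := by
  obtain ⟨x, hx, rfl⟩ := hΩc
  have hsub := connectedComponentIn_subset (X \ supp11 X T) x
  have hopen : IsOpen (connectedComponentIn (X \ supp11 X T) x) :=
    (isOpen_diff_supp11 hX T).connectedComponentIn
  have key : ∀ S₁ S₂ : (Fin n → ℂ) → ℂ, ContDiffOn ℝ (⊤ : ℕ∞) S₁ X →
      ContDiffOn ℝ (⊤ : ℕ∞) S₂ X → (∀ j k, ∀ z ∈ X, T j k z = ddbar X S₁ j k z) →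
      (∀ j k, ∀ z ∈ X, T j k z = ddbar X S₂ j k z) →
      suppIn X S₁ ∩ connectedComponentIn (X \ supp11 X T) x = ∅ →
      suppIn X S₂ ∩ connectedComponentIn (X \ supp11 X T) x = ∅ → Set.EqOn S₁ S₂ X := by
    intro S₁ S₂ h₁ h₂ hT₁ hT₂ hd₁ hd₂ z hz
    refine sub_eq_zero.1 (eqOn_zero_of_ddbar_eq_zero hX hXconn.isPreconnected (h₁.sub h₂)
      (fun j k w hw => ?_) hx.1 ?_ hz)
    · exact (ddbar_sub hX h₁ h₂ j k hw).trans
        (by rw [← hT₁ j k w hw, ← hT₂ j k w hw, sub_self])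
    · filter_upwards [hopen.mem_nhds (mem_connectedComponentIn hx)] with w hw
      simp [eq_zero_of_suppIn_inter_eq_empty hd₁ (hsub hw).1 hw,
        eq_zero_of_suppIn_inter_eq_empty hd₂ (hsub hw).1 hw]
  have hdisj : supp11 X T ∩ connectedComponentIn (X \ supp11 X T) x = ∅ :=
    Set.eq_empty_iff_forall_notMem.2 fun w hw => (hsub hw.2).2 hw.1
  exact ⟨key S U hS hU hTS hTU hSΩ hUΩ, fun S₁ S₂ h₁ h₂ hT₁ hT₂ hs₁ hs₂ =>
    key S₁ S₂ h₁ h₂ hT₁ hT₂ (hs₁ ▸ hdisj) (hs₂ ▸ hdisj)⟩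
end
end
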